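/- (Key inequality (28) in the proof of Theorem A(a), truncated version) Let u be a weak stationary solution density and let U be a Lyapunov function in 𝒰 with respect to ℒ with Lyapunov constant γ > 0, essential lower bound ρ_m and essential upper bound ρ_M. Let ρ_m < ρ_0 < ρ < ρ_M and let φ : ℝ → ℝ be a C², nondecreasing function with φ(t) = 0 for t ≤ ρ_m and φ(t) = t for t ≥ ρ_0. Then ∫_{Ω_ρ \ Ω_{ρ_m}} φ'(U(x)) (ℒU)(x) u(x) dx ≥ − ∫_{Ω_ρ \ Ω_{ρ_m}} φ''(U(x)) ⟨a(x)∇U(x), ∇U(x)⟩ u(x) dx. (No regularity assumption on the level set U^{-1}(ρ) is required.) -/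

import Mathlib

open MeasureTheory

noncomputable section

/-- Euclidean space ℝⁿ. -/
abbrev Eucl (n : ℕ) : Type := EuclideanSpace ℝ (Fin n)

/-- First-order partial derivative `∂ᵢ f`. -/
def pd {n : ℕ} (f : Eucl n → ℝ) (i : Fin n) (x : Eucl n) : ℝ :=
  fderiv ℝ f x (EuclideanSpace.single i 1)

/-- Second-order partial derivative `∂²ᵢⱼ f`. -/
def pd2 {n : ℕ} (f : Eucl n → ℝ) (i j : Fin n) (x : Eucl n) : ℝ :=
  fderiv ℝ (fun y => fderiv ℝ f y (EuclideanSpace.single j 1)) x (EuclideanSpace.single i 1)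

/-- The adjoint Fokker–Planck operator `ℒf = aⁱʲ ∂²ᵢⱼ f + Vⁱ ∂ᵢ f`. -/
def Lop {n : ℕ} (a : Eucl n → Matrix (Fin n) (Fin n) ℝ)
    (V : Eucl n → Fin n → ℝ) (f : Eucl n → ℝ) (x : Eucl n) : ℝ :=
  (∑ i, ∑ j, a x i j * pd2 f i j x) + ∑ i, V x i * pd f i x

/-- The quadratic form `⟨a(x) ∇f(x), ∇f(x)⟩ = ∑ᵢⱼ aⁱʲ ∂ᵢf ∂ⱼf`. -/
def aQuad {n : ℕ} (a : Eucl n → Matrix (Fin n) (Fin n) ℝ)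
    (f : Eucl n → ℝ) (x : Eucl n) : ℝ :=
  ∑ i, ∑ j, a x i j * pd f i x * pd f j x

open scoped Convolution Topology ContDiff

section PartialDerivatives

variable {n : ℕ}

lemma pd_congr {f g : Eucl n → ℝ} {x : Eucl n} (h : f =ᶠ[𝓝 x] g) (i : Fin n) :
    pd f i x = pd g i x := by
  simp only [pd, h.fderiv_eq]

lemma pd2_eq_pd_pd (f : Eucl n → ℝ) (i j : Fin n) (x : Eucl n) :
    pd2 f i j x = pd (pd f j) i x := rfl

lemma pd2_congr {f g : Eucl n → ℝ} {x : Eucl n} (h : f =ᶠ[𝓝 x] g) (i j : Fin n) :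
    pd2 f i j x = pd2 g i j x :=
  pd_congr (h.eventuallyEq_nhds.mono fun _ hy => pd_congr hy j) i

lemma Lop_congr {a : Eucl n → Matrix (Fin n) (Fin n) ℝ} {V : Eucl n → Fin n → ℝ}
    {f g : Eucl n → ℝ} {x : Eucl n} (h : f =ᶠ[𝓝 x] g) : Lop a V f x = Lop a V g x := by
  simp only [Lop, pd_congr h, pd2_congr h]

lemma Lop_eq_zero_of_notMem_tsupport {a : Eucl n → Matrix (Fin n) (Fin n) ℝ}
    {V : Eucl n → Fin n → ℝ} {f : Eucl n → ℝ} {x : Eucl n} (hx : x ∉ tsupport f) :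
    Lop a V f x = 0 := by
  rw [Lop_congr (notMem_tsupport_iff_eventuallyEq.mp hx)]
  simp [Lop, pd2, pd]

lemma contDiffOn_pd {s : Set (Eucl n)} (hs : IsOpen s) {f : Eucl n → ℝ} {m k : WithTop ℕ∞}
    (hf : ContDiffOn ℝ k f s) (hmk : m + 1 ≤ k) (i : Fin n) : ContDiffOn ℝ m (pd f i) s :=
  (hf.fderiv_of_isOpen hs hmk).clm_apply contDiffOn_const

lemma contDiff_pd {f : Eucl n → ℝ} {m k : WithTop ℕ∞}
    (hf : ContDiff ℝ k f) (hmk : m + 1 ≤ k) (i : Fin n) : ContDiff ℝ m (pd f i) :=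
  (hf.fderiv_right hmk).clm_apply contDiff_const

lemma continuousOn_pd {s : Set (Eucl n)} (hs : IsOpen s) {f : Eucl n → ℝ}
    (hf : ContDiffOn ℝ 1 f s) (i : Fin n) : ContinuousOn (pd f i) s :=
  (contDiffOn_pd hs hf (m := 0) (by norm_num) i).continuousOn

lemma continuousOn_pd2 {s : Set (Eucl n)} (hs : IsOpen s) {f : Eucl n → ℝ}
    (hf : ContDiffOn ℝ 2 f s) (i j : Fin n) : ContinuousOn (pd2 f i j) s :=
  continuousOn_pd hs (contDiffOn_pd hs hf (m := 1) (by norm_num) j) i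

lemma HasCompactSupport.pd {f : Eucl n → ℝ} (hf : HasCompactSupport f) (i : Fin n) :
    HasCompactSupport (pd f i) :=
  hf.fderiv_apply ℝ _

lemma continuousOn_Lop {a : Eucl n → Matrix (Fin n) (Fin n) ℝ} {V : Eucl n → Fin n → ℝ}
    {s : Set (Eucl n)} (hs : IsOpen s) (ha : ∀ i j, ContinuousOn (fun x => a x i j) s)
    (hV : ContinuousOn V s) {f : Eucl n → ℝ} (hf : ContDiffOn ℝ 2 f s) :
    ContinuousOn (Lop a V f) s := by
  have h1 := continuousOn_pd hs (hf.of_le one_le_two)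
  have h2 := continuousOn_pd2 hs hf
  have hV' := continuousOn_pi.mp hV
  unfold Lop
  fun_prop

lemma continuousOn_aQuad {a : Eucl n → Matrix (Fin n) (Fin n) ℝ}
    {s : Set (Eucl n)} (hs : IsOpen s) (ha : ∀ i j, ContinuousOn (fun x => a x i j) s)
    {f : Eucl n → ℝ} (hf : ContDiffOn ℝ 1 f s) :
    ContinuousOn (aQuad a f) s := by
  have h1 := continuousOn_pd hs hf
  unfold aQuad
  fun_prop

lemma pd_comp {η : ℝ → ℝ} {U : Eucl n → ℝ} {x : Eucl n} (hη : DifferentiableAt ℝ η (U x))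
    (hU : DifferentiableAt ℝ U x) (i : Fin n) :
    pd (η ∘ U) i x = deriv η (U x) * pd U i x := by
  simp only [pd]
  rw [fderiv_comp x hη hU]
  simp [mul_comm]

lemma Lop_comp {s : Set (Eucl n)} (hs : IsOpen s) (a : Eucl n → Matrix (Fin n) (Fin n) ℝ)
    (V : Eucl n → Fin n → ℝ) {η : ℝ → ℝ} {U : Eucl n → ℝ} (hη : ContDiff ℝ 2 η)
    (hU : ContDiffOn ℝ 2 U s) {x : Eucl n} (hx : x ∈ s) :
    Lop a V (η ∘ U) x =
      deriv η (U x) * Lop a V U x + deriv (deriv η) (U x) * aQuad a U x := by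
  have hηd : Differentiable ℝ η := hη.differentiable two_ne_zero
  rw [← one_add_one_eq_two] at hη
  have hη' : Differentiable ℝ (deriv η) := hη.deriv'.differentiable one_ne_zero
  have hUd : ∀ y ∈ s, DifferentiableAt ℝ U y := fun y hy =>
    (hU.differentiableOn two_ne_zero).differentiableAt (hs.mem_nhds hy)
  have hpd : ∀ j, DifferentiableAt ℝ (pd U j) x := fun j =>
    ((contDiffOn_pd hs hU (m := 1) (by norm_num) j).differentiableOn
      one_ne_zero).differentiableAt (hs.mem_nhds hx)
  have h2 : ∀ i j, pd2 (η ∘ U) i j x =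
      deriv η (U x) * pd2 U i j x + deriv (deriv η) (U x) * (pd U i x * pd U j x) := by
    intro i j
    have hev : pd (η ∘ U) j =ᶠ[𝓝 x] fun y => (deriv η ∘ U) y * pd U j y := by
      filter_upwards [hs.mem_nhds hx] with y hy
      exact pd_comp (hηd _) (hUd y hy) j
    rw [pd2_eq_pd_pd, pd_congr hev, pd,
      fderiv_fun_mul ((hη' _).comp x (hUd x hx)) (hpd j)]
    have := pd_comp (hη' _) (hUd x hx) i
    rw [pd] at this
    simp only [add_apply, smul_apply, this, smul_eq_mul,
      Function.comp_apply, pd2_eq_pd_pd]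
    rw [pd.eq_def (pd U j)]
    ring
  simp only [Lop, aQuad, h2, pd_comp (hηd _) (hUd x hx), mul_add, Finset.sum_add_distrib,
    Finset.mul_sum]
  rw [add_right_comm]
  congr 1
  · congr 1 <;> refine Finset.sum_congr rfl fun i _ => ?_
    · exact Finset.sum_congr rfl fun j _ => by ring
    · ring
  · exact Finset.sum_congr rfl fun i _ => Finset.sum_congr rfl fun j _ => by ring

end PartialDerivatives

section Mollification

variable {n : ℕ}

lemma pd_convolution {g f : Eucl n → ℝ} (hg : Continuous g) (hf : ContDiff ℝ 1 f)
    (hfc : HasCompactSupport f) (i : Fin n) :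
    pd (g ⋆[ContinuousLinearMap.lsmul ℝ ℝ] f) i =
      g ⋆[ContinuousLinearMap.lsmul ℝ ℝ] pd f i := by
  ext x
  rw [pd, (hfc.hasFDerivAt_convolution_right _ hg.locallyIntegrable hf x).fderiv,
    convolution_precompR_apply _ hg.locallyIntegrable (hfc.fderiv ℝ)
      (hf.continuous_fderiv one_ne_zero)]
  rfl

/-- A compactly supported `C²` function can be approximated by smooth functions supported close
to its support, uniformly together with its derivatives of order one and two. -/
lemma exists_smooth_approx {f : Eucl n → ℝ} (hf : ContDiff ℝ 2 f) (hfc : HasCompactSupport f)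
    {δ ε : ℝ} (hδ : 0 < δ) (hε : 0 < ε) :
    ∃ g : Eucl n → ℝ, ContDiff ℝ ∞ g ∧
      tsupport g ⊆ Metric.cthickening δ (tsupport f) ∧
      (∀ i x, |pd g i x - pd f i x| ≤ ε) ∧ ∀ i j x, |pd2 g i j x - pd2 f i j x| ≤ ε := by
  have hpd1 : ∀ i, ContDiff ℝ 1 (pd f i) := contDiff_pd hf (by norm_num)
  have hpdc : ∀ i, HasCompactSupport (pd f i) := hfc.pd
  have hc1 : ∀ i, Continuous (pd f i) := fun i => (hpd1 i).continuous
  have hc2 : ∀ i j, Continuous (pd2 f i j) := fun i j =>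
    (contDiff_pd (m := 0) (hpd1 j) (by norm_num) i).continuous
  have hu : ∀ h : Eucl n → ℝ, Continuous h → HasCompactSupport h →
      ∀ᶠ r in 𝓝[>] (0 : ℝ), ∀ x y, dist x y < r → dist (h x) (h y) ≤ ε := by
    intro h hh hhc
    obtain ⟨r, hr, H⟩ :=
      Metric.uniformContinuous_iff.mp (hhc.uniformContinuous_of_continuous hh) ε hε
    filter_upwards [Ioo_mem_nhdsGT hr] with s hs x y hxy
    exact (H (hxy.trans hs.2)).le
  have hall : ∀ᶠ r in 𝓝[>] (0 : ℝ), (0 < r ∧ r < δ) ∧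
      (∀ i, ∀ x y, dist x y < r → dist (pd f i x) (pd f i y) ≤ ε) ∧
      ∀ i j, ∀ x y, dist x y < r → dist (pd2 f i j x) (pd2 f i j y) ≤ ε := by
    refine (Filter.Eventually.and (Ioo_mem_nhdsGT hδ) (Filter.Eventually.and ?_ ?_))
    · exact Filter.eventually_all.mpr fun i => hu _ (hc1 i) (hpdc i)
    · exact Filter.eventually_all.mpr fun i => Filter.eventually_all.mpr fun j =>
        hu _ (hc2 i j) ((hpdc j).pd i)
  obtain ⟨r, ⟨hr0, hrδ⟩, h1, h2⟩ := hall.exists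
  let b : ContDiffBump (0 : Eucl n) := ⟨r / 2, r, by positivity, by linarith⟩
  have hbc : Continuous (b.normed volume) := b.continuous_normed
  refine ⟨b.normed volume ⋆[ContinuousLinearMap.lsmul ℝ ℝ] f,
    b.hasCompactSupport_normed.contDiff_convolution_left _ b.contDiff_normed
      hf.continuous.locallyIntegrable, ?_, ?_, ?_⟩
  · refine closure_minimal ?_ Metric.isClosed_cthickening
    intro x hx
    obtain ⟨y, hy, z, hz, rfl⟩ := support_convolution_subset _ hx
    rw [b.support_normed_eq] at hy
    refine Metric.mem_cthickening_of_dist_le _ z _ _ (subset_tsupport _ hz) ?_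
    have : ‖y‖ < r := by simpa using hy
    simpa using (this.trans hrδ).le
  · intro i x
    rw [pd_convolution hbc (hf.of_le one_le_two) hfc, ← Real.dist_eq]
    exact b.dist_normed_convolution_le (hc1 i).aestronglyMeasurable
      fun y hy => h1 i y x hy
  · intro i j x
    rw [pd2_eq_pd_pd, pd_convolution hbc (hf.of_le one_le_two) hfc,
      pd_convolution hbc (hpd1 j) (hpdc j), ← Real.dist_eq]
    exact b.dist_normed_convolution_le (hc2 i j).aestronglyMeasurable
      fun y hy => h2 i j y x hy

end Mollification

section StationaryDensity

variable {n : ℕ}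

lemma abs_Lop_sub_Lop_le (a : Eucl n → Matrix (Fin n) (Fin n) ℝ) (V : Eucl n → Fin n → ℝ)
    {f g : Eucl n → ℝ} {x : Eucl n} {ε : ℝ} (h1 : ∀ i, |pd g i x - pd f i x| ≤ ε)
    (h2 : ∀ i j, |pd2 g i j x - pd2 f i j x| ≤ ε) :
    |Lop a V g x - Lop a V f x| ≤ ε * ((∑ i, ∑ j, |a x i j|) + ∑ i, |V x i|) := by
  have h : Lop a V g x - Lop a V f x =
      (∑ i, ∑ j, a x i j * (pd2 g i j x - pd2 f i j x)) +
        ∑ i, V x i * (pd g i x - pd f i x) := by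
    simp only [Lop, mul_sub, Finset.sum_sub_distrib]
    ring
  rw [h, mul_add, Finset.mul_sum, Finset.mul_sum]
  refine (abs_add_le _ _).trans (add_le_add ?_ ?_)
  · refine (Finset.abs_sum_le_sum_abs _ _).trans (Finset.sum_le_sum fun i _ => ?_)
    rw [Finset.mul_sum]
    refine (Finset.abs_sum_le_sum_abs _ _).trans (Finset.sum_le_sum fun j _ => ?_)
    rw [abs_mul, mul_comm]
    exact mul_le_mul_of_nonneg_right (h2 i j) (abs_nonneg _)
  · refine (Finset.abs_sum_le_sum_abs _ _).trans (Finset.sum_le_sum fun i _ => ?_)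
    rw [abs_mul, mul_comm]
    exact mul_le_mul_of_nonneg_right (h1 i) (abs_nonneg _)

lemma setIntegral_Lop_mul_eq {a : Eucl n → Matrix (Fin n) (Fin n) ℝ} {V : Eucl n → Fin n → ℝ}
    {u f : Eucl n → ℝ} {s K : Set (Eucl n)} (hs : MeasurableSet s) (hKs : K ⊆ s)
    (hf : tsupport f ⊆ K) :
    ∫ x in s, Lop a V f x * u x = ∫ x in K, Lop a V f x * u x :=
  setIntegral_eq_of_subset_of_forall_sdiff_eq_zero hs hKs fun x hx => by
    rw [Lop_eq_zero_of_notMem_tsupport fun h => hx.2 (hf h), zero_mul]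

/-- The weak stationarity identity extends from smooth to `C²` compactly supported functions. -/
lemma setIntegral_Lop_mul_eq_zero {𝒰 : Set (Eucl n)} (hUopen : IsOpen 𝒰)
    {a : Eucl n → Matrix (Fin n) (Fin n) ℝ} (ha : ∀ i j, ContinuousOn (fun x => a x i j) 𝒰)
    {V : Eucl n → Fin n → ℝ} (hV : ContinuousOn V 𝒰)
    {u : Eucl n → ℝ} (hu : ContinuousOn u 𝒰)
    (hu_stat : ∀ f : Eucl n → ℝ, ContDiff ℝ (⊤ : ℕ∞) f → HasCompactSupport f →
      tsupport f ⊆ 𝒰 → (∫ x in 𝒰, Lop a V f x * u x) = 0)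
    {f : Eucl n → ℝ} (hf : ContDiff ℝ 2 f) (hfc : HasCompactSupport f) (hfs : tsupport f ⊆ 𝒰) :
    ∫ x in 𝒰, Lop a V f x * u x = 0 := by
  obtain ⟨δ, hδ, hδs⟩ := hfc.isCompact.exists_cthickening_subset_open hUopen hfs
  set K := Metric.cthickening δ (tsupport f)
  have hK : IsCompact K := hfc.isCompact.cthickening
  have hint : ∀ g : Eucl n → ℝ, ContDiff ℝ 2 g →
      IntegrableOn (fun x => Lop a V g x * u x) K := fun g hg =>
    (((continuousOn_Lop hUopen ha hV hg.contDiffOn).mul hu).mono hδs).integrableOn_compact hK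
  let W : Eucl n → ℝ := fun x => ((∑ i, ∑ j, |a x i j|) + ∑ i, |V x i|) * |u x|
  have hW : IntegrableOn W K := by
    have hV' := continuousOn_pi.mp hV
    have : ContinuousOn W 𝒰 := by fun_prop
    exact (this.mono hδs).integrableOn_compact hK
  have key : ∀ ε > 0, |∫ x in K, Lop a V f x * u x| ≤ ε * ∫ x in K, W x := by
    intro ε hε
    obtain ⟨g, hg, hgs, h1, h2⟩ := exists_smooth_approx hf hfc hδ hε
    have hg2 : ContDiff ℝ 2 g := contDiff_infty.mp hg 2
    have h0 := hu_stat g hg (hK.of_isClosed_subset (isClosed_tsupport g) hgs) (hgs.trans hδs)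
    rw [setIntegral_Lop_mul_eq hUopen.measurableSet hδs hgs] at h0
    have hsub := integral_sub (hint g hg2) (hint f hf)
    rw [h0, zero_sub] at hsub
    rw [← abs_neg, ← hsub, ← integral_const_mul, ← Real.norm_eq_abs]
    refine norm_integral_le_of_norm_le (hW.const_mul ε) (Filter.Eventually.of_forall fun x => ?_)
    rw [← sub_mul, Real.norm_eq_abs, abs_mul, ← mul_assoc]
    exact mul_le_mul_of_nonneg_right
      (abs_Lop_sub_Lop_le a V (fun i => h1 i x) fun i j => h2 i j x) (abs_nonneg _)
  rw [setIntegral_Lop_mul_eq hUopen.measurableSet hδs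
    (Metric.self_subset_cthickening _), ← abs_nonpos_iff]
  have hlim : Filter.Tendsto (fun ε : ℝ => ε * ∫ x in K, W x) (𝓝[>] 0) (𝓝 0) := by
    have : Continuous fun ε : ℝ => ε * ∫ x in K, W x := by fun_prop
    simpa using (this.tendsto 0).mono_left nhdsWithin_le_nhds
  exact ge_of_tendsto hlim (Filter.eventually_of_mem self_mem_nhdsWithin key)

/-- A `C²` function of `U` vanishing at and above the level `ρ` is an admissible test function. -/
lemma setIntegral_Lop_comp_eq_zero {𝒰 : Set (Eucl n)} (hUopen : IsOpen 𝒰)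
    {a : Eucl n → Matrix (Fin n) (Fin n) ℝ} (ha : ∀ i j, ContinuousOn (fun x => a x i j) 𝒰)
    {V : Eucl n → Fin n → ℝ} (hV : ContinuousOn V 𝒰)
    {u : Eucl n → ℝ} (hu : ContinuousOn u 𝒰)
    (hu_stat : ∀ f : Eucl n → ℝ, ContDiff ℝ (⊤ : ℕ∞) f → HasCompactSupport f →
      tsupport f ⊆ 𝒰 → (∫ x in 𝒰, Lop a V f x * u x) = 0)
    {U : Eucl n → ℝ} (hU : ContDiffOn ℝ 2 U 𝒰) {ρ : ℝ} (hK : IsCompact {x ∈ 𝒰 | U x ≤ ρ})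
    {η : ℝ → ℝ} (hη : ContDiff ℝ 2 η) (hη0 : ∀ t, ρ ≤ t → η t = 0) :
    ∫ x in {x ∈ 𝒰 | U x ≤ ρ},
      (deriv η (U x) * Lop a V U x + deriv (deriv η) (U x) * aQuad a U x) * u x = 0 := by
  set K := {x ∈ 𝒰 | U x ≤ ρ}
  have hK𝒰 : K ⊆ 𝒰 := Set.sep_subset _ _
  let f : Eucl n → ℝ := 𝒰.indicator (η ∘ U)
  have hfeq : ∀ x ∈ 𝒰, f =ᶠ[𝓝 x] η ∘ U := fun x hx =>
    Filter.eventuallyEq_of_mem (hUopen.mem_nhds hx) (Set.eqOn_indicator)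
  have hsupp : tsupport f ⊆ K := by
    refine closure_minimal (fun x hx => ?_) hK.isClosed
    have hx𝒰 : x ∈ 𝒰 := Set.mem_of_indicator_ne_zero hx
    refine ⟨hx𝒰, le_of_not_gt fun h => hx ?_⟩
    simp [f, hx𝒰, hη0 _ h.le]
  have hf : ContDiff ℝ 2 f := by
    rw [contDiff_iff_contDiffAt]
    intro x
    by_cases hx : x ∈ 𝒰
    · exact (hη.contDiffAt.comp x (hU.contDiffAt (hUopen.mem_nhds hx))).congr_of_eventuallyEq
        (hfeq x hx)
    · exact contDiffAt_const.congr_of_eventuallyEq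
        (notMem_tsupport_iff_eventuallyEq.mp fun h => hx (hK𝒰 (hsupp h)))
  have h0 := setIntegral_Lop_mul_eq_zero hUopen ha hV hu hu_stat hf
    (hK.of_isClosed_subset (isClosed_tsupport f) hsupp) (hsupp.trans hK𝒰)
  rw [setIntegral_Lop_mul_eq hUopen.measurableSet hK𝒰 hsupp] at h0
  rw [← h0]
  refine setIntegral_congr_fun hK.measurableSet fun x hx => ?_
  simp only [Lop_congr (hfeq x hx.1), Lop_comp hUopen a V hη hU hx.1]

/-- Testing the stationarity identity with a cut-off of `φ ∘ U` above the level `ρ`: the term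
involving the derivative of the cut-off `χ` has a sign. -/
lemma setIntegral_cutoff_nonneg {𝒰 : Set (Eucl n)} (hUopen : IsOpen 𝒰)
    {a : Eucl n → Matrix (Fin n) (Fin n) ℝ} (ha : ∀ i j, ContinuousOn (fun x => a x i j) 𝒰)
    (ha_psd : ∀ x ∈ 𝒰, ∀ v : Fin n → ℝ, 0 ≤ ∑ i, ∑ j, a x i j * v i * v j)
    {V : Eucl n → Fin n → ℝ} (hV : ContinuousOn V 𝒰)
    {u : Eucl n → ℝ} (hu : ContinuousOn u 𝒰) (hu_nonneg : ∀ x ∈ 𝒰, 0 ≤ u x)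
    (hu_stat : ∀ f : Eucl n → ℝ, ContDiff ℝ (⊤ : ℕ∞) f → HasCompactSupport f →
      tsupport f ⊆ 𝒰 → (∫ x in 𝒰, Lop a V f x * u x) = 0)
    {U : Eucl n → ℝ} (hU : ContDiffOn ℝ 2 U 𝒰) {ρ : ℝ} (hK : IsCompact {x ∈ 𝒰 | U x ≤ ρ})
    {φ : ℝ → ℝ} (hφ : ContDiff ℝ 2 φ) (hφ_mono : Monotone φ)
    {χ : ℝ → ℝ} (hχ : ContDiff ℝ 1 χ) (hχ_anti : Antitone χ) (hχ0 : ∀ t, ρ ≤ t → χ t = 0) :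
    0 ≤ ∫ x in {x ∈ 𝒰 | U x ≤ ρ},
      χ (U x) * ((deriv φ (U x) * Lop a V U x + deriv (deriv φ) (U x) * aQuad a U x) * u x) := by
  set K := {x ∈ 𝒰 | U x ≤ ρ}
  have hK𝒰 : K ⊆ 𝒰 := Set.sep_subset _ _
  have hφ' : ContDiff ℝ 1 (deriv φ) := by
    rw [← one_add_one_eq_two] at hφ
    exact hφ.deriv'
  have hmul : ContDiff ℝ 1 fun t => deriv φ t * χ t := hφ'.mul hχ
  let η : ℝ → ℝ := fun t => ∫ s in ρ..t, deriv φ s * χ s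
  have hηd : ∀ t, HasDerivAt η (deriv φ t * χ t) t := fun t =>
    hmul.continuous.integral_hasStrictDerivAt ρ t |>.hasDerivAt
  have hηderiv : deriv η = fun t => deriv φ t * χ t := funext fun t => (hηd t).deriv
  have hη : ContDiff ℝ 2 η := by
    rw [← one_add_one_eq_two, contDiff_succ_iff_deriv]
    exact ⟨fun t => (hηd t).differentiableAt, by simp, hηderiv ▸ hmul⟩
  have hη0 : ∀ t, ρ ≤ t → η t = 0 := fun t ht =>
    intervalIntegral.integral_zero_ae (Filter.Eventually.of_forall fun s hs => by
      rw [Set.uIoc_of_le ht] at hs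
      rw [hχ0 s hs.1.le, mul_zero])
  have hηdd : ∀ t, deriv (deriv η) t = deriv (deriv φ) t * χ t + deriv φ t * deriv χ t := by
    intro t
    rw [hηderiv]
    exact deriv_fun_mul (hφ'.differentiable one_ne_zero t) (hχ.differentiable one_ne_zero t)
  have hLU := (continuousOn_Lop hUopen ha hV hU).mono hK𝒰
  have hQU := (continuousOn_aQuad hUopen ha (hU.of_le one_le_two)).mono hK𝒰
  have huK := hu.mono hK𝒰
  have hUK := hU.continuousOn.mono hK𝒰
  have hcomp : ∀ {h : ℝ → ℝ}, Continuous h → ContinuousOn (fun x => h (U x)) K :=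
    fun hh => hh.comp_continuousOn hUK
  have hdφU := hcomp hφ'.continuous
  have hddφU := hcomp (hφ'.continuous_deriv le_rfl)
  have hχU := hcomp hχ.continuous
  have hdηU := hcomp (hηderiv ▸ hmul.continuous : Continuous (deriv η))
  have hddηU := hcomp ((hηderiv ▸ hmul : ContDiff ℝ 1 (deriv η)).continuous_deriv le_rfl)
  rw [← setIntegral_Lop_comp_eq_zero hUopen ha hV hu hu_stat hU hK hη hη0]
  refine setIntegral_mono_on (ContinuousOn.integrableOn_compact hK (by fun_prop))
    (ContinuousOn.integrableOn_compact hK (hχU.mul (by fun_prop))) hK.measurableSet fun x hx => ?_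
  have hQ : 0 ≤ aQuad a U x := ha_psd x hx.1 fun i => pd U i x
  have hneg : deriv φ (U x) * deriv χ (U x) ≤ 0 :=
    mul_nonpos_of_nonneg_of_nonpos hφ_mono.deriv_nonneg hχ_anti.deriv_nonpos
  rw [hηdd, congrFun hηderiv, ← mul_assoc]
  refine mul_le_mul_of_nonneg_right ?_ (hu_nonneg x hx.1)
  linarith [mul_nonpos_of_nonpos_of_nonneg hneg hQ]

/-- Key inequality with the cut-off removed. -/
lemma setIntegral_sublevel_nonneg {𝒰 : Set (Eucl n)} (hUopen : IsOpen 𝒰)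
    {a : Eucl n → Matrix (Fin n) (Fin n) ℝ} (ha : ∀ i j, ContinuousOn (fun x => a x i j) 𝒰)
    (ha_psd : ∀ x ∈ 𝒰, ∀ v : Fin n → ℝ, 0 ≤ ∑ i, ∑ j, a x i j * v i * v j)
    {V : Eucl n → Fin n → ℝ} (hV : ContinuousOn V 𝒰)
    {u : Eucl n → ℝ} (hu : ContinuousOn u 𝒰) (hu_nonneg : ∀ x ∈ 𝒰, 0 ≤ u x)
    (hu_stat : ∀ f : Eucl n → ℝ, ContDiff ℝ (⊤ : ℕ∞) f → HasCompactSupport f →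
      tsupport f ⊆ 𝒰 → (∫ x in 𝒰, Lop a V f x * u x) = 0)
    {U : Eucl n → ℝ} (hU : ContDiffOn ℝ 2 U 𝒰) {ρ : ℝ} (hK : IsCompact {x ∈ 𝒰 | U x ≤ ρ})
    {φ : ℝ → ℝ} (hφ : ContDiff ℝ 2 φ) (hφ_mono : Monotone φ) :
    0 ≤ ∫ x in {x ∈ 𝒰 | U x < ρ},
      (deriv φ (U x) * Lop a V U x + deriv (deriv φ) (U x) * aQuad a U x) * u x := by
  set K := {x ∈ 𝒰 | U x ≤ ρ}
  set S := {x ∈ 𝒰 | U x < ρ}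
  set G : Eucl n → ℝ := fun x =>
    (deriv φ (U x) * Lop a V U x + deriv (deriv φ) (U x) * aQuad a U x) * u x
  have hK𝒰 : K ⊆ 𝒰 := Set.sep_subset _ _
  have hSK : S ⊆ K := fun x hx => ⟨hx.1, hx.2.le⟩
  have hS : MeasurableSet S :=
    (hU.continuousOn.isOpen_inter_preimage hUopen isOpen_Iio).measurableSet
  have hφ' : ContDiff ℝ 1 (deriv φ) := by
    rw [← one_add_one_eq_two] at hφ
    exact hφ.deriv'
  have hUK := hU.continuousOn.mono hK𝒰
  have hG : ContinuousOn G K := by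
    have hLU := (continuousOn_Lop hUopen ha hV hU).mono hK𝒰
    have hQU := (continuousOn_aQuad hUopen ha (hU.of_le one_le_two)).mono hK𝒰
    have huK := hu.mono hK𝒰
    have hdφU := hφ'.continuous.comp_continuousOn' hUK
    have hddφU := (hφ'.continuous_deriv le_rfl).comp_continuousOn' hUK
    fun_prop
  let χ : ℕ → ℝ → ℝ := fun k t => Real.smoothTransition (k * (ρ - t))
  have hχ : ∀ k, ContDiff ℝ 1 (χ k) := fun k =>
    Real.smoothTransition.contDiff.comp (by fun_prop)
  have hχ_anti : ∀ k, Antitone (χ k) := fun k s t hst =>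
    Real.smoothTransition.monotone (by gcongr)
  have hχ0 : ∀ k t, ρ ≤ t → χ k t = 0 := fun k t ht =>
    Real.smoothTransition.zero_of_nonpos
      (mul_nonpos_of_nonneg_of_nonpos k.cast_nonneg (sub_nonpos.mpr ht))
  have hlim : Filter.Tendsto (fun k => ∫ x in K, χ k (U x) * G x) Filter.atTop
      (𝓝 (∫ x in K, S.indicator G x)) := by
    refine tendsto_integral_of_dominated_convergence (fun x => ‖G x‖) (fun k => ?_)
      (hG.integrableOn_compact hK).norm (fun k => ?_) ?_
    · exact (((hχ k).continuous.comp_continuousOn hUK).mul hG).aestronglyMeasurable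
        hK.measurableSet
    · refine Filter.Eventually.of_forall fun x => ?_
      rw [norm_mul]
      refine mul_le_of_le_one_left (norm_nonneg _) ?_
      rw [Real.norm_of_nonneg (Real.smoothTransition.nonneg _)]
      exact Real.smoothTransition.le_one _
    · refine ae_restrict_of_forall_mem hK.measurableSet fun x hx => ?_
      by_cases hxρ : U x < ρ
      · rw [Set.indicator_of_mem (show x ∈ S from ⟨hx.1, hxρ⟩)]
        refine tendsto_const_nhds.congr' ?_
        have hk : Filter.Tendsto (fun k : ℕ => (k : ℝ) * (ρ - U x)) Filter.atTop Filter.atTop :=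
          tendsto_natCast_atTop_atTop.atTop_mul_const (sub_pos.mpr hxρ)
        filter_upwards [hk.eventually_ge_atTop 1] with k hk
        simp only [χ, Real.smoothTransition.one_of_one_le hk, one_mul]
      · rw [Set.indicator_of_notMem fun h => hxρ h.2]
        simp only [hχ0 _ _ (not_lt.mp hxρ), zero_mul, tendsto_const_nhds]
  rw [setIntegral_indicator hS, Set.inter_eq_right.mpr hSK] at hlim
  exact ge_of_tendsto' hlim fun k => setIntegral_cutoff_nonneg hUopen ha ha_psd hV hu hu_nonneg
    hu_stat hU hK hφ hφ_mono (hχ k) (hχ_anti k) (hχ0 k)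

end StationaryDensity

/-- Key inequality (28) in the proof of Theorem A(a), truncated version. -/
theorem key_inequality_28
    {n : ℕ} (hn : 0 < n)
    (𝒰 : Set (Eucl n)) (hUopen : IsOpen 𝒰) (hUconn : IsConnected 𝒰)
    (a : Eucl n → Matrix (Fin n) (Fin n) ℝ)
    (ha_C1 : ∀ i j, ContDiffOn ℝ 1 (fun x => a x i j) 𝒰)
    (ha_symm : ∀ x ∈ 𝒰, ∀ i j, a x i j = a x j i)
    (ha_psd : ∀ x ∈ 𝒰, ∀ v : Fin n → ℝ, 0 ≤ ∑ i, ∑ j, a x i j * v i * v j)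
    (V : Eucl n → Fin n → ℝ) (hV_cont : ContinuousOn V 𝒰)
    (u : Eucl n → ℝ) (hu_C1 : ContDiffOn ℝ 1 u 𝒰) (hu_nonneg : ∀ x ∈ 𝒰, 0 ≤ u x)
    (hu_mass : (∫ x in 𝒰, u x) = 1)
    (hu_stat : ∀ f : Eucl n → ℝ, ContDiff ℝ (⊤ : ℕ∞) f → HasCompactSupport f →
      tsupport f ⊆ 𝒰 → (∫ x in 𝒰, Lop a V f x * u x) = 0)
    (U : Eucl n → ℝ) (ρM : EReal) (hU_C2 : ContDiffOn ℝ 2 U 𝒰)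
    (hU_nonneg : ∀ x ∈ 𝒰, 0 ≤ U x)
    (hU_lt : ∀ x ∈ 𝒰, (U x : EReal) < ρM)
    (hU_sup : ρM = ⨆ x : 𝒰, (U x.1 : EReal))
    (hU_cpt : ∀ ρ : ℝ, (ρ : EReal) < ρM → IsCompact {x ∈ 𝒰 | U x ≤ ρ})
    (ρm γ : ℝ) (hρm_pos : 0 < ρm) (hρm_lt : (ρm : EReal) < ρM) (hγ : 0 < γ)
    (hLyap : ∀ x ∈ 𝒰, x ∉ closure {y ∈ 𝒰 | U y < ρm} → Lop a V U x ≤ -γ)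
    (ρ0 ρ : ℝ) (hρ0 : ρm < ρ0) (hρ0ρ : ρ0 < ρ) (hρρM : (ρ : EReal) < ρM)
    (φ : ℝ → ℝ) (hφ_C2 : ContDiff ℝ 2 φ) (hφ_mono : Monotone φ)
    (hφ_low : ∀ t : ℝ, t ≤ ρm → φ t = 0) (hφ_high : ∀ t : ℝ, ρ0 ≤ t → φ t = t) :
    -(∫ x in {x ∈ 𝒰 | ρm ≤ U x ∧ U x < ρ}, deriv (deriv φ) (U x) * aQuad a U x * u x) ≤
      ∫ x in {x ∈ 𝒰 | ρm ≤ U x ∧ U x < ρ}, deriv φ (U x) * Lop a V U x * u x := by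
  have ha : ∀ i j, ContinuousOn (fun x => a x i j) 𝒰 := fun i j => (ha_C1 i j).continuousOn
  have hu := hu_C1.continuousOn
  have hK := hU_cpt ρ hρρM
  have hUc := hU_C2.continuousOn
  have hmain := setIntegral_sublevel_nonneg hUopen ha ha_psd hV_cont hu hu_nonneg hu_stat hU_C2 hK
    hφ_C2 hφ_mono
  have hφ' : ContDiff ℝ 1 (deriv φ) := by
    rw [← one_add_one_eq_two] at hφ_C2
    exact hφ_C2.deriv'
  have hlow : ∀ t < ρm, deriv φ =ᶠ[𝓝 t] fun _ => 0 := fun t ht => by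
    have h : φ =ᶠ[𝓝 t] fun _ => 0 := by
      filter_upwards [Iio_mem_nhds ht] with s hs using hφ_low s hs.le
    filter_upwards [h.deriv] with s hs
    rw [hs, deriv_const]
  set S := {x ∈ 𝒰 | ρm ≤ U x ∧ U x < ρ}
  have hSK : S ⊆ {x ∈ 𝒰 | U x ≤ ρ} := fun x hx => ⟨hx.1, hx.2.2.le⟩
  have hS𝒰 : S ⊆ 𝒰 := Set.sep_subset _ _
  have hΩ : MeasurableSet {x ∈ 𝒰 | U x < ρ} :=
    (hUc.isOpen_inter_preimage hUopen isOpen_Iio).measurableSet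
  rw [setIntegral_eq_of_subset_of_forall_sdiff_eq_zero (s := S) hΩ
    (fun x hx => ⟨hx.1, hx.2.2⟩) fun x hx => by
      have hx' : U x < ρm := lt_of_not_ge fun h => hx.2 ⟨hx.1.1, h, hx.1.2⟩
      rw [(hlow _ hx').eq_of_nhds, (hlow _ hx').deriv_eq, deriv_const]
      ring] at hmain
  have hLU := continuousOn_Lop hUopen ha hV_cont hU_C2
  have hQU := continuousOn_aQuad hUopen ha (hU_C2.of_le one_le_two)
  have hdφU := hφ'.continuous.comp_continuousOn' hUc
  have hddφU := (hφ'.continuous_deriv le_rfl).comp_continuousOn' hUc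
  have hint : ∀ {h : Eucl n → ℝ}, ContinuousOn h 𝒰 → IntegrableOn h S := fun hh =>
    ((hh.mono (Set.sep_subset _ _)).integrableOn_compact hK).mono_set hSK
  simp only [add_mul] at hmain
  rw [integral_add (hint (by fun_prop)) (hint (by fun_prop))] at hmain
  linarith
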